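/- Let φ : A → B be a DG quasi-smooth homomorphism of strongly commutative DG R-algebras with diagonal ideal J and filtration {J^[ℓ]}. Suppose N is a semifree DG B-module such that Ext^i_B(N, N ⊗_B J/J^[ℓ]) = 0 for all i ≥ 0 and some fixed ℓ ≥ 1. Then the natural inclusion J^[ℓ] ↪ J induces isomorphisms Ext^i_B(N, N ⊗_B J^[ℓ]) ≅ Ext^i_B(N, N ⊗_B J) for all i ≥ 1. -/

import Mathlib

/-!
Common framework: strongly commutative non-negatively graded DG algebras over a
commutative ring `R`, right DG modules, semifree DG modules, Ext via the Hom complex,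
homotopies, enveloping DG algebras, diagonal ideals, DG (quasi-)smoothness,
polynomial and free (divided power) extensions, and naive lifting.
-/

noncomputable section

/-- The Koszul sign `(-1)^i` for an integer `i`. -/
def ksign (i : ℤ) : ℤ := (((-1 : ℤˣ) ^ i : ℤˣ) : ℤ)

/-- A strongly commutative, non-negatively graded differential graded algebra over a
commutative ring `R`: a graded `R`-algebra `A = ⊕_{n ≥ 0} A_n` with
`a * b = (-1)^{|a||b|} b * a`, `a^2 = 0` for `|a|` odd, and an `R`-linear degree `-1`
differential `d` with `d ∘ d = 0` satisfying the Leibniz rule. -/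
structure DGAlgebra (R : Type) [CommRing R] where
  carrier : Type
  [ring : Ring carrier]
  [alg : Algebra R carrier]
  grading : ℤ → Submodule R carrier
  indep : ∀ i : ℤ, Disjoint (grading i) (⨆ j ≠ i, grading j)
  spanning : (⨆ i, grading i) = ⊤
  nonneg : ∀ i : ℤ, i < 0 → grading i = ⊥
  one_mem : (1 : carrier) ∈ grading 0
  mul_mem : ∀ {i j : ℤ} {a b : carrier}, a ∈ grading i → b ∈ grading j →
    a * b ∈ grading (i + j)
  gcomm : ∀ {i j : ℤ} (a b : carrier), a ∈ grading i → b ∈ grading j →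
    a * b = ksign (i * j) • (b * a)
  odd_sq : ∀ {i : ℤ} (a : carrier), Odd i → a ∈ grading i → a * a = 0
  d : carrier → carrier
  d_add : ∀ a b, d (a + b) = d a + d b
  d_rsmul : ∀ (r : R) a, d (r • a) = r • d a
  d_mem : ∀ {i : ℤ} {a : carrier}, a ∈ grading i → d a ∈ grading (i - 1)
  d_sq : ∀ a, d (d a) = 0
  leibniz : ∀ {i : ℤ} (a b : carrier), a ∈ grading i →
    d (a * b) = d a * b + ksign i • (a * d b)

attribute [instance] DGAlgebra.ring DGAlgebra.alg

variable {R : Type} [CommRing R]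

/-- A right DG module over a DG `R`-algebra `A`. -/
structure DGModule (R : Type) [CommRing R] (A : DGAlgebra R) where
  carrier : Type
  [acg : AddCommGroup carrier]
  [modR : Module R carrier]
  grading : ℤ → Submodule R carrier
  indep : ∀ i : ℤ, Disjoint (grading i) (⨆ j ≠ i, grading j)
  spanning : (⨆ i, grading i) = ⊤
  smul : carrier → A.carrier → carrier
  smul_add : ∀ (m : carrier) (a b : A.carrier), smul m (a + b) = smul m a + smul m b
  add_smul : ∀ (m n : carrier) (a : A.carrier), smul (m + n) a = smul m a + smul n a
  smul_rsmul : ∀ (r : R) (m : carrier) (a : A.carrier), smul m (r • a) = r • smul m a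
  rsmul_smul : ∀ (r : R) (m : carrier) (a : A.carrier), smul (r • m) a = r • smul m a
  smul_one : ∀ m : carrier, smul m 1 = m
  smul_mul : ∀ (m : carrier) (a b : A.carrier), smul (smul m a) b = smul m (a * b)
  smul_mem : ∀ {i j : ℤ} {m : carrier} {a : A.carrier},
    m ∈ grading i → a ∈ A.grading j → smul m a ∈ grading (i + j)
  d : carrier → carrier
  d_add : ∀ x y, d (x + y) = d x + d y
  d_rsmul : ∀ (r : R) x, d (r • x) = r • d x
  d_mem : ∀ {i : ℤ} {m : carrier}, m ∈ grading i → d m ∈ grading (i - 1)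
  d_sq : ∀ m, d (d m) = 0
  leibniz : ∀ {i : ℤ} (m : carrier) (a : A.carrier), m ∈ grading i →
    d (smul m a) = smul (d m) a + ksign i • smul m (A.d a)

attribute [instance] DGModule.acg DGModule.modR

/-- A graded `A`-linear map of degree `k` between DG `A`-modules (not necessarily
compatible with the differentials). -/
structure GradedHom {A : DGAlgebra R} (M N : DGModule R A) (k : ℤ) where
  toFun : M.carrier → N.carrier
  map_add : ∀ x y, toFun (x + y) = toFun x + toFun y
  map_rsmul : ∀ (r : R) x, toFun (r • x) = r • toFun x
  map_smul : ∀ (x : M.carrier) (a : A.carrier), toFun (M.smul x a) = N.smul (toFun x) a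
  map_mem : ∀ {i : ℤ} {x : M.carrier}, x ∈ M.grading i → toFun x ∈ N.grading (i + k)

/-- A homomorphism of DG `A`-modules: a degree `0` graded `A`-linear chain map. -/
structure DGHom {A : DGAlgebra R} (M N : DGModule R A) where
  toFun : M.carrier → N.carrier
  map_add : ∀ x y, toFun (x + y) = toFun x + toFun y
  map_rsmul : ∀ (r : R) x, toFun (r • x) = r • toFun x
  map_smul : ∀ (x : M.carrier) (a : A.carrier), toFun (M.smul x a) = N.smul (toFun x) a
  map_mem : ∀ {i : ℤ} {x : M.carrier}, x ∈ M.grading i → toFun x ∈ N.grading i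
  comm_d : ∀ x, toFun (M.d x) = N.d (toFun x)

/-- A degree `-k` element `f` of the Hom complex `Hom_A(N, M)` is a cocycle
(representing a class in `Ext^k_A(N,M) = H_{-k}(Hom_A(N,M))`). -/
def IsExtCocycle {A : DGAlgebra R} {N M : DGModule R A} (k : ℤ)
    (f : GradedHom N M (-k)) : Prop :=
  ∀ x, M.d (f.toFun x) = ksign k • f.toFun (N.d x)

/-- A degree `-k` cocycle of the Hom complex is a coboundary. -/
def IsExtCoboundary {A : DGAlgebra R} {N M : DGModule R A} (k : ℤ)
    (f : GradedHom N M (-k)) : Prop :=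
  ∃ h : GradedHom N M (-k + 1), ∀ x,
    f.toFun x = M.d (h.toFun x) + ksign k • h.toFun (N.d x)

/-- `Ext^k_A(N, M) = H_{-k}(Hom_A(N, M)) = 0`. -/
def ExtVanish {A : DGAlgebra R} (k : ℤ) (N M : DGModule R A) : Prop :=
  ∀ f : GradedHom N M (-k), IsExtCocycle k f → IsExtCoboundary k f

/-- A DG module homomorphism `j : M' → M` induces an isomorphism
`Ext^k_A(N, M') ≅ Ext^k_A(N, M)`; stated at the level of cocycles and coboundaries
of the Hom complexes (injectivity and surjectivity of the induced map on `H_{-k}`). -/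
def InducesExtIso {A : DGAlgebra R} (k : ℤ) (N : DGModule R A) {M' M : DGModule R A}
    (j : DGHom M' M) : Prop :=
  (∀ f : GradedHom N M' (-k), IsExtCocycle k f →
    (∃ h : GradedHom N M (-k + 1), ∀ x,
      j.toFun (f.toFun x) = M.d (h.toFun x) + ksign k • h.toFun (N.d x)) →
    IsExtCoboundary k f) ∧
  (∀ g : GradedHom N M (-k), IsExtCocycle k g →
    ∃ f : GradedHom N M' (-k), IsExtCocycle k f ∧
      ∃ h : GradedHom N M (-k + 1), ∀ x,
        j.toFun (f.toFun x) - g.toFun x = M.d (h.toFun x) + ksign k • h.toFun (N.d x))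

/-- Two maps of DG `A`-modules are homotopic: `f - g = ∂ ∘ h + h ∘ ∂` for a graded
`A`-linear map `h` of degree `1`. -/
def DGHomotopic {A : DGAlgebra R} {M N : DGModule R A}
    (f g : M.carrier → N.carrier) : Prop :=
  ∃ h : GradedHom M N 1, ∀ x, f x - g x = N.d (h.toFun x) + h.toFun (M.d x)

/-- A DG module homomorphism `j : M' → M` induces a bijection
`Hom_{K(A)}(N, M') ≅ Hom_{K(A)}(N, M)` on homotopy classes of DG homomorphisms. -/
def InducesHtpyBij {A : DGAlgebra R} (N : DGModule R A) {M' M : DGModule R A}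
    (j : DGHom M' M) : Prop :=
  (∀ f g : DGHom N M',
    DGHomotopic (fun x => j.toFun (f.toFun x)) (fun x => j.toFun (g.toFun x)) →
    DGHomotopic f.toFun g.toFun) ∧
  (∀ g : DGHom N M, ∃ f : DGHom N M',
    DGHomotopic (fun x => j.toFun (f.toFun x)) g.toFun)

/-- A semifree basis of a DG `A`-module `N` on a family `e : κ → N`: a well-ordering
of `κ`, degrees making each `e k` homogeneous, such that `e` is a basis of the
underlying graded `A`-module and `∂(e k) ∈ Σ_{j < k} (e j)·A`. -/
structure SemifreeBasisOn {A : DGAlgebra R} (N : DGModule R A) {κ : Type}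
    (e : κ → N.carrier) where
  lt : κ → κ → Prop
  wf : WellFounded lt
  trans : ∀ a b c, lt a b → lt b c → lt a c
  trichotomous : ∀ a b, lt a b ∨ a = b ∨ lt b a
  deg : κ → ℤ
  homog : ∀ k, e k ∈ N.grading (deg k)
  basis : Function.Bijective
    (fun c : κ →₀ A.carrier => c.sum fun k a => N.smul (e k) a)
  d_lower : ∀ k, ∃ c : κ →₀ A.carrier, (∀ j ∈ c.support, lt j k) ∧
    N.d (e k) = c.sum fun j a => N.smul (e j) a

/-- A DG `A`-module is semifree if it admits a semifree basis. -/
def IsSemifree {A : DGAlgebra R} (N : DGModule R A) : Prop :=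
  ∃ (κ : Type) (e : κ → N.carrier), Nonempty (SemifreeBasisOn N e)

/-- A DG `A`-module has a finite semifree basis. -/
def HasFiniteSemifreeBasis {A : DGAlgebra R} (N : DGModule R A) : Prop :=
  ∃ (κ : Type) (e : κ → N.carrier), Finite κ ∧ Nonempty (SemifreeBasisOn N e)

/-- A DG module is bounded below: `N_i = 0` for `i ≪ 0`. -/
def BoundedBelow {A : DGAlgebra R} (N : DGModule R A) : Prop :=
  ∃ n₀ : ℤ, ∀ i : ℤ, i < n₀ → N.grading i = ⊥

/-- A homomorphism of DG `R`-algebras. -/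
structure DGAlgHom (A B : DGAlgebra R) where
  toFun : A.carrier → B.carrier
  map_one : toFun 1 = 1
  map_mul : ∀ x y, toFun (x * y) = toFun x * toFun y
  map_add : ∀ x y, toFun (x + y) = toFun x + toFun y
  map_rsmul : ∀ (r : R) x, toFun (r • x) = r • toFun x
  map_mem : ∀ {i : ℤ} {x : A.carrier}, x ∈ A.grading i → toFun x ∈ B.grading i
  comm_d : ∀ x, toFun (A.d x) = B.d (toFun x)

/-- A DG `A`-module homomorphism from a DG `A`-module `M` to (the restriction of
scalars along `φ : A → B` of) a DG `B`-module `W`. -/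
structure ResHom {A B : DGAlgebra R} (φ : DGAlgHom A B) (M : DGModule R A)
    (W : DGModule R B) where
  toFun : M.carrier → W.carrier
  map_add : ∀ x y, toFun (x + y) = toFun x + toFun y
  map_rsmul : ∀ (r : R) x, toFun (r • x) = r • toFun x
  map_mem : ∀ {i : ℤ} {x : M.carrier}, x ∈ M.grading i → toFun x ∈ W.grading i
  map_smul : ∀ (x : M.carrier) (a : A.carrier),
    toFun (M.smul x a) = W.smul (toFun x) (φ.toFun a)
  comm_d : ∀ x, toFun (M.d x) = W.d (toFun x)

/-- `T` is (up to isomorphism) the base change `M ⊗_A B` of the DG `A`-module `M`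
along `φ : A → B`: universal property of the unit map `M → T`, `m ↦ m ⊗ 1`. -/
structure DGBaseChange {A B : DGAlgebra R} (φ : DGAlgHom A B) (M : DGModule R A)
    (T : DGModule R B) where
  unit : ResHom φ M T
  univ : ∀ (W : DGModule R B) (f : ResHom φ M W),
    ∃ g : DGHom T W, (∀ x, g.toFun (unit.toFun x) = f.toFun x) ∧
      ∀ g' : DGHom T W, (∀ x, g'.toFun (unit.toFun x) = f.toFun x) →
        ∀ t, g'.toFun t = g.toFun t

/-- A DG `B`-module `W` is liftable to `A` along `φ : A → B` if `W ≅ M ⊗_A B`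
for some DG `A`-module `M`. -/
def LiftableTo {A B : DGAlgebra R} (φ : DGAlgHom A B) (W : DGModule R B) : Prop :=
  ∃ M : DGModule R A, Nonempty (DGBaseChange φ M W)

/-- An `A`-linear (via `φ : A → B`) chain map between the restrictions of two
DG `B`-modules. -/
structure ResHomB {A B : DGAlgebra R} (φ : DGAlgHom A B) (N W : DGModule R B) where
  toFun : N.carrier → W.carrier
  map_add : ∀ x y, toFun (x + y) = toFun x + toFun y
  map_rsmul : ∀ (r : R) x, toFun (r • x) = r • toFun x
  map_mem : ∀ {i : ℤ} {x : N.carrier}, x ∈ N.grading i → toFun x ∈ W.grading i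
  map_smul : ∀ (x : N.carrier) (a : A.carrier),
    toFun (N.smul x (φ.toFun a)) = W.smul (toFun x) (φ.toFun a)
  comm_d : ∀ x, toFun (N.d x) = W.d (toFun x)

/-- `T` is (up to isomorphism) the induced DG `B`-module `N|_A ⊗_A B` of a
DG `B`-module `N` along `φ : A → B`, with unit map `n ↦ n ⊗ 1`. -/
structure InducedModuleSpec {A B : DGAlgebra R} (φ : DGAlgHom A B)
    (N T : DGModule R B) where
  unit : ResHomB φ N T
  univ : ∀ (W : DGModule R B) (f : ResHomB φ N W),
    ∃ g : DGHom T W, (∀ x, g.toFun (unit.toFun x) = f.toFun x) ∧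
      ∀ g' : DGHom T W, (∀ x, g'.toFun (unit.toFun x) = f.toFun x) →
        ∀ t, g'.toFun t = g.toFun t

/-- `N` is naively liftable to `A` along `φ : A → B`: the canonical DG `B`-module
epimorphism `π_N : N|_A ⊗_A B → N`, `n ⊗ b ↦ nb` (characterized as the unique
DG `B`-map splitting the unit) admits a right inverse DG `B`-module homomorphism. -/
def NaivelyLiftable {A B : DGAlgebra R} (φ : DGAlgHom A B) (N : DGModule R B) : Prop :=
  ∀ (T : DGModule R B) (h : InducedModuleSpec φ N T) (πN : DGHom T N),
    (∀ x, πN.toFun (h.unit.toFun x) = x) →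
    ∃ ρ : DGHom N T, ∀ y, πN.toFun (ρ.toFun y) = y

/-- `N` is a direct summand of `W` as DG modules. -/
def IsDGDirectSummandOf {A : DGAlgebra R} (N W : DGModule R A) : Prop :=
  ∃ (ρ : DGHom N W) (p : DGHom W N), ∀ x, p.toFun (ρ.toFun x) = x

/-- `N` is a direct summand of some DG `B`-module which is liftable to `A`. -/
def DirectSummandOfLiftable {A B : DGAlgebra R} (φ : DGAlgHom A B)
    (N : DGModule R B) : Prop :=
  ∃ W : DGModule R B, LiftableTo φ W ∧ IsDGDirectSummandOf N W

/-- `B` is free as an underlying graded `A`-module (via `φ : A → B`), with a basis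
of homogeneous elements. -/
def FreeOverBase {A B : DGAlgebra R} (φ : DGAlgHom A B) : Prop :=
  ∃ (κ : Type) (e : κ → B.carrier) (dg : κ → ℤ),
    (∀ k, e k ∈ B.grading (dg k)) ∧
    Function.Bijective (fun c : κ →₀ A.carrier => c.sum fun k a => e k * φ.toFun a)

/-- `E` is (up to isomorphism) the enveloping DG algebra `B^e = B^o ⊗_A B` of
`φ : A → B`: it receives the two canonical maps `l : B° → E`, `b ↦ b^o ⊗ 1` and
`r : B → E`, `b ↦ 1^o ⊗ b` agreeing on `A`, and is universal (as a pushout of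
strongly commutative DG algebras) with this property. -/
structure EnvelopingAlg {A B : DGAlgebra R} (φ : DGAlgHom A B) (E : DGAlgebra R) where
  l : DGAlgHom B E
  r : DGAlgHom B E
  compat : ∀ a, l.toFun (φ.toFun a) = r.toFun (φ.toFun a)
  univ : ∀ (C : DGAlgebra R) (f g : DGAlgHom B C),
    (∀ a, f.toFun (φ.toFun a) = g.toFun (φ.toFun a)) →
    ∃ h : DGAlgHom E C, (∀ b, h.toFun (l.toFun b) = f.toFun b) ∧
      (∀ b, h.toFun (r.toFun b) = g.toFun b) ∧
      ∀ h' : DGAlgHom E C,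
        ((∀ b, h'.toFun (l.toFun b) = f.toFun b) ∧
          (∀ b, h'.toFun (r.toFun b) = g.toFun b)) → ∀ x, h'.toFun x = h.toFun x

/-- The diagonal ideal `J = ker(π_B : B^e → B)`. -/
def diagIdeal {A B E : DGAlgebra R} {φ : DGAlgHom A B} (_ : EnvelopingAlg φ E)
    (πB : DGAlgHom E B) : Set E.carrier :=
  {x | πB.toFun x = 0}

/-- A balanced pairing `N × S → W` realizing (maps out of) `N ⊗_B (S/Z)`, where
`S ⊆ B^e` is a DG `(B,B)`-sub-bimodule of `B^e` (left `B`-action via `l`, right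
`B`-action via `r`) and `Z ⊆ S` is killed. -/
structure TensorPairing {A B E : DGAlgebra R} (φ : DGAlgHom A B)
    (he : EnvelopingAlg φ E) (S Z : Set E.carrier) (N W : DGModule R B) where
  pair : N.carrier → E.carrier → W.carrier
  add_left : ∀ n n' x, x ∈ S → pair (n + n') x = pair n x + pair n' x
  add_right : ∀ n x y, x ∈ S → y ∈ S → pair n (x + y) = pair n x + pair n y
  rsmul_left : ∀ (r : R) n x, x ∈ S → pair (r • n) x = r • pair n x
  rsmul_right : ∀ (r : R) n x, x ∈ S → pair n (r • x) = r • pair n x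
  balanced : ∀ (n : N.carrier) (b : B.carrier) (x : E.carrier), x ∈ S →
    pair (N.smul n b) x = pair n (he.l.toFun b * x)
  act_right : ∀ (n : N.carrier) (b : B.carrier) (x : E.carrier), x ∈ S →
    pair n (x * he.r.toFun b) = W.smul (pair n x) b
  grade : ∀ {i j : ℤ} (n : N.carrier) (x : E.carrier),
    n ∈ N.grading i → x ∈ S → x ∈ E.grading j → pair n x ∈ W.grading (i + j)
  chain : ∀ {i : ℤ} (n : N.carrier) (x : E.carrier), n ∈ N.grading i → x ∈ S →
    W.d (pair n x) = pair (N.d n) x + ksign i • pair n (E.d x)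
  kill : ∀ n x, x ∈ Z → pair n x = 0

/-- `P` is (up to isomorphism) the right DG `B`-module `N ⊗_B (S/Z)`:
universal property among balanced pairings. -/
structure IsTensorSubquot {A B E : DGAlgebra R} (φ : DGAlgHom A B)
    (he : EnvelopingAlg φ E) (S Z : Set E.carrier) (N P : DGModule R B) where
  pairing : TensorPairing φ he S Z N P
  univ : ∀ (W : DGModule R B) (γ : TensorPairing φ he S Z N W),
    ∃ g : DGHom P W, (∀ n x, x ∈ S → g.toFun (pairing.pair n x) = γ.pair n x) ∧
      ∀ g' : DGHom P W, (∀ n x, x ∈ S → g'.toFun (pairing.pair n x) = γ.pair n x) →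
        ∀ p, g'.toFun p = g.toFun p

/-- `Q` is (up to isomorphism) the quotient `S/Z` of DG `B^e`-submodules
`Z ⊆ S ⊆ B^e`, regarded as a right DG `B`-module via `r : B → B^e`. -/
structure SubquotModSpec {A B E : DGAlgebra R} {φ : DGAlgHom A B}
    (he : EnvelopingAlg φ E) (S Z : Set E.carrier) (Q : DGModule R B) where
  q : E.carrier → Q.carrier
  q_add : ∀ x y, x ∈ S → y ∈ S → q (x + y) = q x + q y
  q_rsmul : ∀ (r : R) x, x ∈ S → q (r • x) = r • q x
  q_mem : ∀ {i : ℤ} (x : E.carrier), x ∈ S → x ∈ E.grading i → q x ∈ Q.grading i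
  q_d : ∀ x, x ∈ S → q (E.d x) = Q.d (q x)
  q_act : ∀ (x : E.carrier) (b : B.carrier), x ∈ S →
    q (x * he.r.toFun b) = Q.smul (q x) b
  q_surj : ∀ y, ∃ x ∈ S, q x = y
  q_ker : ∀ x, x ∈ S → (q x = 0 ↔ x ∈ Z)

/-- The data exhibiting `φ : A → B` as DG quasi-smooth, relative to a realization
`E` of the enveloping DG algebra `B^e` and the multiplication map `π_B : B^e → B`:
`B` is graded-free over `A` and the diagonal ideal `J = ker π_B` carries a filtration
`J = J^[1] ⊇ J^[2] ⊇ ⋯` of DG `B^e`-submodules with `J·J^[ℓ] + J^[ℓ]·J ⊆ J^[ℓ+1]`,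
`inf J^[ℓ] ≥ ℓ`, and all subquotients `J^[ℓ]/J^[ℓ+1]` semifree over `B`. -/
structure QuasiSmoothData {A B : DGAlgebra R} (φ : DGAlgHom A B) (E : DGAlgebra R)
    (he : EnvelopingAlg φ E) (πB : DGAlgHom E B) where
  pil : ∀ b, πB.toFun (he.l.toFun b) = b
  pir : ∀ b, πB.toFun (he.r.toFun b) = b
  free : FreeOverBase φ
  filt : ℕ → Set E.carrier
  filt_one : filt 1 = {x | πB.toFun x = 0}
  filt_desc : ∀ ℓ, 1 ≤ ℓ → filt (ℓ + 1) ⊆ filt ℓ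
  filt_zero : ∀ ℓ, (0 : E.carrier) ∈ filt ℓ
  filt_add : ∀ ℓ x y, x ∈ filt ℓ → y ∈ filt ℓ → x + y ∈ filt ℓ
  filt_neg : ∀ ℓ x, x ∈ filt ℓ → -x ∈ filt ℓ
  filt_rsmul : ∀ ℓ (r : R) x, x ∈ filt ℓ → r • x ∈ filt ℓ
  filt_act : ∀ ℓ (e : E.carrier) x, x ∈ filt ℓ → x * e ∈ filt ℓ
  filt_d : ∀ ℓ x, x ∈ filt ℓ → E.d x ∈ filt ℓ
  filt_graded : ∀ ℓ x, x ∈ filt ℓ →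
    x ∈ Submodule.span R (filt ℓ ∩ ⋃ i : ℤ, (E.grading i : Set E.carrier))
  filt_mul : ∀ ℓ, 1 ≤ ℓ → ∀ a x, πB.toFun a = 0 → x ∈ filt ℓ →
    a * x ∈ filt (ℓ + 1) ∧ x * a ∈ filt (ℓ + 1)
  filt_inf : ∀ ℓ : ℕ, 1 ≤ ℓ → ∀ i : ℤ, i < (ℓ : ℤ) →
    ∀ x ∈ filt ℓ, x ∈ E.grading i → x = 0
  quot_semifree : ∀ ℓ, 1 ≤ ℓ → ∃ Q : DGModule R B,
    Nonempty (SubquotModSpec he (filt ℓ) (filt (ℓ + 1)) Q) ∧ IsSemifree Q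

/-- The data exhibiting `φ : A → B` as DG smooth: quasi-smooth, and all
subquotients `J^[ℓ]/J^[ℓ+1]` have finite semifree bases. -/
structure SmoothData {A B : DGAlgebra R} (φ : DGAlgHom A B) (E : DGAlgebra R)
    (he : EnvelopingAlg φ E) (πB : DGAlgHom E B)
    extends QuasiSmoothData φ E he πB where
  quot_finite : ∀ ℓ, 1 ≤ ℓ → ∃ Q : DGModule R B,
    Nonempty (SubquotModSpec he (filt ℓ) (filt (ℓ + 1)) Q) ∧ HasFiniteSemifreeBasis Q

/-- A DG `A`-submodule of a DG `A`-module `M`: an `R`-submodule closed under the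
`A`-action and the differential and generated by homogeneous elements. -/
structure DGSubmodule {A : DGAlgebra R} (M : DGModule R A) where
  toSubmodule : Submodule R M.carrier
  smul_mem' : ∀ (x : M.carrier) (a : A.carrier), x ∈ toSubmodule →
    M.smul x a ∈ toSubmodule
  d_mem' : ∀ x ∈ toSubmodule, M.d x ∈ toSubmodule
  graded' : ∀ x ∈ toSubmodule, x ∈ Submodule.span R
    ((toSubmodule : Set M.carrier) ∩ ⋃ i : ℤ, (M.grading i : Set M.carrier))

/-- `P` (with projections `proj`) is the direct product of the family `Ms` in the
category of DG `A`-modules. -/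
def IsDGProduct {A : DGAlgebra R} (Ms : ℕ → DGModule R A) (P : DGModule R A)
    (proj : ∀ ℓ, DGHom P (Ms ℓ)) : Prop :=
  ∀ (W : DGModule R A) (f : ∀ ℓ, DGHom W (Ms ℓ)),
    ∃ g : DGHom W P, (∀ ℓ x, (proj ℓ).toFun (g.toFun x) = (f ℓ).toFun x) ∧
      ∀ g' : DGHom W P, (∀ ℓ x, (proj ℓ).toFun (g'.toFun x) = (f ℓ).toFun x) →
        ∀ x, g'.toFun x = g.toFun x

/-- `M'` is the `k`-th shift `Σ^k M` of the DG `A`-module `M`. -/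
structure DGShiftSpec {A : DGAlgebra R} (k : ℤ) (M M' : DGModule R A) where
  toFun : M.carrier → M'.carrier
  bij : Function.Bijective toFun
  map_add : ∀ x y, toFun (x + y) = toFun x + toFun y
  map_rsmul : ∀ (r : R) x, toFun (r • x) = r • toFun x
  map_mem : ∀ {i : ℤ} (x : M.carrier), x ∈ M.grading i → toFun x ∈ M'.grading (i + k)
  map_smul : ∀ (x : M.carrier) (a : A.carrier), toFun (M.smul x a) = M'.smul (toFun x) a
  map_d : ∀ x, M'.d (toFun x) = ksign k • toFun (M.d x)

/-- `C` is the mapping cone of `f : X → Y`: a degreewise split extension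
`0 → Y → C → ΣX → 0` whose twisting term is `f`. -/
structure DGConeSpec {A : DGAlgebra R} {X Y : DGModule R A} (f : DGHom X Y)
    (C : DGModule R A) where
  inl : DGHom Y C
  inl_inj : Function.Injective inl.toFun
  pr : GradedHom C X (-1)
  pr_d : ∀ c, pr.toFun (C.d c) = - X.d (pr.toFun c)
  sec : GradedHom X C 1
  pr_sec : ∀ x, pr.toFun (sec.toFun x) = x
  pr_inl : ∀ y, pr.toFun (inl.toFun y) = 0
  split : ∀ c, ∃ y, c = inl.toFun y + sec.toFun (pr.toFun c)
  sec_d : ∀ x, C.d (sec.toFun x) = - sec.toFun (X.d x) + inl.toFun (f.toFun x)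

/-- A system of divided powers on (the homogeneous elements of positive even degree
of) a DG `R`-algebra. -/
structure DGDividedPowers (A : DGAlgebra R) where
  dpow : ℕ → A.carrier → A.carrier
  dpow_zero : ∀ {i : ℤ} (u : A.carrier), 0 < i → Even i → u ∈ A.grading i →
    dpow 0 u = 1
  dpow_one : ∀ {i : ℤ} (u : A.carrier), 0 < i → Even i → u ∈ A.grading i →
    dpow 1 u = u
  dpow_mem : ∀ {i : ℤ} (u : A.carrier) (m : ℕ), 0 < i → Even i → u ∈ A.grading i →
    dpow m u ∈ A.grading ((m : ℤ) * i)
  dpow_mul : ∀ {i : ℤ} (u : A.carrier) (m l : ℕ), 0 < i → Even i → u ∈ A.grading i →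
    dpow m u * dpow l u = ((m + l).choose m : ℤ) • dpow (m + l) u
  dpow_add : ∀ {i : ℤ} (u v : A.carrier) (m : ℕ), 0 < i → Even i →
    u ∈ A.grading i → v ∈ A.grading i →
    dpow m (u + v) = ∑ j ∈ Finset.range (m + 1), dpow j u * dpow (m - j) v
  dpow_odd_mul : ∀ {i j : ℤ} (u v : A.carrier) (m : ℕ), Odd i → Odd j →
    u ∈ A.grading i → v ∈ A.grading j → 2 ≤ m → dpow m (u * v) = 0
  dpow_even_mul : ∀ {i j : ℤ} (u v : A.carrier) (m : ℕ), Even i → Even j → 0 < j →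
    u ∈ A.grading i → v ∈ A.grading j → dpow m (u * v) = u ^ m * dpow m v
  dpow_comp : ∀ {i : ℤ} (u : A.carrier) (m l : ℕ), 0 < i → Even i →
    u ∈ A.grading i → 1 ≤ m →
    dpow l (dpow m u) =
      (Nat.factorial (m * l) / (Nat.factorial l * (Nat.factorial m) ^ l)) •
        dpow (m * l) u

/-- The index set of monomials in variables `ι` (with divided/ordinary powers):
finitely supported exponent functions, with exponents at most `1` on odd-degree
variables. -/
def MonIdx (ι : Type) (degX : ι → ℤ) : Type :=
  {m : ι →₀ ℕ // ∀ i, Odd (degX i) → m i ≤ 1}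

/-- Total weight (number of symbols) of a monomial index. -/
def monWeight {ι : Type} {degX : ι → ℤ} (m : MonIdx ι degX) : ℕ :=
  m.1.sum fun _ k => k

/-- The monomial `∏_i g i (m i)` (product taken in the increasing order of the
variables). -/
def gradMonomial {T : Type} [Ring T] {ι : Type} [LinearOrder ι] (degX : ι → ℤ)
    (g : ι → ℕ → T) (m : MonIdx ι degX) : T :=
  ((m.1.support.sort (· ≤ ·)).map fun i => g i (m.1 i)).prod

/-- `B = A[X_i : i ∈ ι]` is a polynomial extension of `A` by the variables `X_i`
of positive degrees `degX i`, adjoined in increasing order of degree, each `d X_i`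
lying in the preceding stage; the monomials in the `X_i` form a basis of `B` as a
graded `A`-module. -/
structure PolyExt {A B : DGAlgebra R} (φ : DGAlgHom A B) (ι : Type) [LinearOrder ι]
    (X : ι → B.carrier) (degX : ι → ℤ) where
  inj : Function.Injective φ.toFun
  pos_deg : ∀ i, 0 < degX i
  mono_deg : Monotone degX
  homog : ∀ i, X i ∈ B.grading (degX i)
  d_prev : ∀ i : ι, ∃ c : MonIdx ι degX →₀ A.carrier,
    (∀ m ∈ c.support, ∀ j : ι, i ≤ j → m.1 j = 0) ∧
    B.d (X i) = c.sum fun m a =>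
      gradMonomial degX (fun i' k => X i' ^ k) m * φ.toFun a
  basis : Function.Bijective (fun c : MonIdx ι degX →₀ A.carrier =>
    c.sum fun m a => gradMonomial degX (fun i' k => X i' ^ k) m * φ.toFun a)

/-- `B = A⟨X_i : i ∈ ι⟩` is a free (divided power) extension of `A` by the
variables `X_i` of positive degrees: odd variables square to zero, even variables
carry divided powers `dp i m` with `d(X^{(m)}) = X^{(m-1)} dX`, and the divided
power monomials form a basis of `B` as a graded `A`-module. -/
structure FreeExt {A B : DGAlgebra R} (φ : DGAlgHom A B) (ι : Type) [LinearOrder ι]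
    (X : ι → B.carrier) (degX : ι → ℤ) where
  inj : Function.Injective φ.toFun
  pos_deg : ∀ i, 0 < degX i
  mono_deg : Monotone degX
  homog : ∀ i, X i ∈ B.grading (degX i)
  dp : ι → ℕ → B.carrier
  dp_zero : ∀ i, dp i 0 = 1
  dp_one : ∀ i, dp i 1 = X i
  dp_odd : ∀ i m, Odd (degX i) → 2 ≤ m → dp i m = 0
  dp_mem : ∀ i (m : ℕ), dp i m ∈ B.grading ((m : ℤ) * degX i)
  dp_mul : ∀ i (m l : ℕ), dp i m * dp i l = ((m + l).choose m : ℤ) • dp i (m + l)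
  dp_d : ∀ i (m : ℕ), 1 ≤ m → B.d (dp i m) = dp i (m - 1) * B.d (X i)
  d_prev : ∀ i : ι, ∃ c : MonIdx ι degX →₀ A.carrier,
    (∀ m ∈ c.support, ∀ j : ι, i ≤ j → m.1 j = 0) ∧
    B.d (X i) = c.sum fun m a => gradMonomial degX dp m * φ.toFun a
  basis : Function.Bijective (fun c : MonIdx ι degX →₀ A.carrier =>
    c.sum fun m a => gradMonomial degX dp m * φ.toFun a)

/-- The diagonal `ξ_i = X_i^o ⊗ 1 - 1^o ⊗ X_i` of the variable `X_i` in `B^e`. -/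
def xiDiag {A B E : DGAlgebra R} {φ : DGAlgHom A B} (he : EnvelopingAlg φ E)
    {ι : Type} (X : ι → B.carrier) (i : ι) : E.carrier :=
  he.l.toFun (X i) - he.r.toFun (X i)

/-- The divided powers `ξ_i^{(m)} = Σ_{j=0}^m (-1)^{m-j} (X_i^{(j)})^o ⊗ X_i^{(m-j)}`
of the diagonal `ξ_i` in `B^e` (zero for `m ≥ 2` when `|X_i|` is odd). -/
def xiDp {A B E : DGAlgebra R} {φ : DGAlgHom A B} (he : EnvelopingAlg φ E)
    {ι : Type} (dp : ι → ℕ → B.carrier) (degX : ι → ℤ) (i : ι) (m : ℕ) :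
    E.carrier :=
  if Odd (degX i) ∧ 2 ≤ m then 0
  else ∑ j ∈ Finset.range (m + 1),
    ((-1 : ℤ) ^ (m - j)) • (he.l.toFun (dp i j) * he.r.toFun (dp i (m - j)))

/-- The monomial `ξ^{(m)} = ξ_{i_1}^{(m_{i_1})} ⋯ ξ_{i_t}^{(m_{i_t})}` in `B^e`
built from the divided powers of the diagonals. -/
def FreeExt.diagMon {A B E : DGAlgebra R} {φ : DGAlgHom A B}
    {ι : Type} [LinearOrder ι] {X : ι → B.carrier} {degX : ι → ℤ}
    (fe : FreeExt φ ι X degX) (he : EnvelopingAlg φ E) (m : MonIdx ι degX) :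
    E.carrier :=
  gradMonomial degX (xiDp he fe.dp degX) m

/-- The `ℓ`-th power `J^{(ℓ)} = Mon_{≥ℓ}(Ω)·B^e` of the diagonal ideal:
right `B^e`-linear combinations of the `ξ`-monomials of weight at least `ℓ`. -/
def FreeExt.diagPow {A B E : DGAlgebra R} {φ : DGAlgHom A B}
    {ι : Type} [LinearOrder ι] {X : ι → B.carrier} {degX : ι → ℤ}
    (fe : FreeExt φ ι X degX) (he : EnvelopingAlg φ E) (ℓ : ℕ) :
    Set E.carrier :=
  {x | ∃ c : MonIdx ι degX →₀ E.carrier, (∀ m ∈ c.support, ℓ ≤ monWeight m) ∧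
    x = c.sum fun m e => fe.diagMon he m * e}

/-- Ordinary-power analogue `J^ℓ` for polynomial extensions. -/
def PolyExt.diagPow {A B E : DGAlgebra R} {φ : DGAlgHom A B}
    {ι : Type} [LinearOrder ι] {X : ι → B.carrier} {degX : ι → ℤ}
    (_ : PolyExt φ ι X degX) (he : EnvelopingAlg φ E) (ℓ : ℕ) :
    Set E.carrier :=
  {x | ∃ c : MonIdx ι degX →₀ E.carrier, (∀ m ∈ c.support, ℓ ≤ monWeight m) ∧
    x = c.sum fun m e =>
      gradMonomial degX (fun i k => (xiDiag he X i) ^ k) m * e}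

/-- Additive closure of the set of products `a * b` with `a ∈ S₁`, `b ∈ S₂`. -/
def setMulClosure {T : Type} [Ring T] (S₁ S₂ : Set T) : Set T :=
  (AddSubmonoid.closure {x | ∃ a ∈ S₁, ∃ b ∈ S₂, x = a * b} : AddSubmonoid T)

/-- The right ideal generated by a set. -/
def rightIdealGen {T : Type} [Ring T] (S : Set T) : Set T :=
  (AddSubmonoid.closure {x | ∃ s ∈ S, ∃ e : T, x = s * e} : AddSubmonoid T)

/-- The two-sided ideal generated by a set. -/
def twoSidedGen {T : Type} [Ring T] (S : Set T) : Set T :=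
  (AddSubmonoid.closure {x | ∃ s ∈ S, ∃ e e' : T, x = e * s * e'} : AddSubmonoid T)

end

section GradedSubmodules

variable {R M : Type} [CommRing R] [AddCommGroup M] [Module R M]

theorem exists_graded_projections {G : ℤ → Submodule R M}
    (indep : ∀ i, Disjoint (G i) (⨆ j ≠ i, G j)) (spanning : (⨆ i, G i) = ⊤) :
    ∃ π : ℤ → M →ₗ[R] M, (∀ i x, π i x ∈ G i) ∧ (∀ i, ∀ x ∈ G i, π i x = x) ∧
      ∀ i j, i ≠ j → ∀ x ∈ G j, π i x = 0 := by
  have hc : ∀ i, IsCompl (G i) (⨆ j ≠ i, G j) := fun i => by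
    refine ⟨indep i, codisjoint_iff.2 (top_le_iff.1 ?_)⟩
    rw [← spanning, iSup_le_iff]
    intro j
    by_cases h : j = i
    · exact h ▸ le_sup_left
    · exact (le_iSup₂_of_le (f := fun j (_ : j ≠ i) => G j) j h le_rfl).trans le_sup_right
  refine ⟨fun i => Submodule.projection _ _ (hc i), fun i x => ?_, fun i x hx => ?_, fun i j hij x hx => ?_⟩
  · exact Submodule.projection_apply_mem (hc i) x
  · exact (Submodule.projection_eq_self_iff (hc i) x).2 hx
  · refine (Submodule.projection_apply_eq_zero_iff (hc i)).2 ?_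
    exact (le_iSup₂_of_le (f := fun j (_ : j ≠ i) => G j) j hij.symm le_rfl) hx

theorem graded_indep_of_projections {G : ℤ → Submodule R M} (π : ℤ → M →ₗ[R] M)
    (hself : ∀ i, ∀ x ∈ G i, π i x = x) (hne : ∀ i j, i ≠ j → ∀ x ∈ G j, π i x = 0) (i : ℤ) :
    Disjoint (G i) (⨆ j ≠ i, G j) := by
  rw [Submodule.disjoint_def]
  intro x hx hx'
  have hle : (⨆ j ≠ i, G j) ≤ LinearMap.ker (π i) :=
    iSup₂_le fun j hj y hy => hne i j hj.symm y hy
  rw [← hself i x hx]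
  exact hle hx'

/-- A grading contained in another grading of the same module agrees with it. -/
theorem graded_le_of_le {G G' : ℤ → Submodule R M}
    (indep : ∀ i, Disjoint (G i) (⨆ j ≠ i, G j)) (spanning : (⨆ i, G' i) = ⊤)
    (hle : ∀ i, G' i ≤ G i) (i : ℤ) : G i ≤ G' i := by
  have hG : (⨆ i, G i) = ⊤ := top_le_iff.1 (spanning ▸ iSup_mono hle)
  obtain ⟨π, -, hself, hne⟩ := exists_graded_projections indep hG
  have key : (⊤ : Submodule R M) ≤ (G' i).comap (π i) := by
    rw [← spanning, iSup_le_iff]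
    intro j x hx
    rw [Submodule.mem_comap]
    by_cases h : i = j
    · subst h
      rwa [hself i x (hle i hx)]
    · rw [hne i j h x (hle j hx)]
      exact zero_mem _
  intro x hx
  have := key (Submodule.mem_top (x := x))
  rwa [Submodule.mem_comap, hself i x hx] at this

/-- The grading on finitely supported functions for which the `k`-th basis vector has
degree `deg k`. -/
noncomputable def finsuppGrading {κ : Type} (G : ℤ → Submodule R M) (deg : κ → ℤ) (i : ℤ) :
    Submodule R (κ →₀ M) :=
  ⨅ k, (G (i - deg k)).comap (Finsupp.lapply k)

theorem mem_finsuppGrading {κ : Type} {G : ℤ → Submodule R M} {deg : κ → ℤ} {i : ℤ}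
    {f : κ →₀ M} : f ∈ finsuppGrading G deg i ↔ ∀ k, f k ∈ G (i - deg k) := by
  simp [finsuppGrading]

theorem single_mem_finsuppGrading {κ : Type} {G : ℤ → Submodule R M} {deg : κ → ℤ} {i : ℤ}
    {k : κ} {x : M} (hx : x ∈ G (i - deg k)) :
    Finsupp.single k x ∈ finsuppGrading G deg i := by
  classical
  rw [mem_finsuppGrading]
  intro j
  rw [Finsupp.single_apply]
  split_ifs with h
  · exact h ▸ hx
  · exact zero_mem _

theorem finsuppGrading_spanning {κ : Type} {G : ℤ → Submodule R M}
    (spanning : (⨆ i, G i) = ⊤) (deg : κ → ℤ) : (⨆ i, finsuppGrading G deg i) = ⊤ := by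
  rw [eq_top_iff]
  intro f _
  induction f using Finsupp.induction_linear with
  | zero => exact zero_mem _
  | add f g hf hg => exact add_mem (hf trivial) (hg trivial)
  | single k x =>
    have key : (⨆ i, G i) ≤ (⨆ i, finsuppGrading G deg i).comap (Finsupp.lsingle k) := by
      refine iSup_le fun i y hy => ?_
      refine Submodule.mem_iSup_of_mem (i + deg k) (single_mem_finsuppGrading ?_)
      simpa using hy
    exact key (spanning ▸ Submodule.mem_top)

theorem finsuppGrading_indep {κ : Type} {G : ℤ → Submodule R M}
    (indep : ∀ i, Disjoint (G i) (⨆ j ≠ i, G j)) (deg : κ → ℤ) (i : ℤ) :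
    Disjoint (finsuppGrading G deg i) (⨆ j ≠ i, finsuppGrading G deg j) := by
  rw [Submodule.disjoint_def]
  intro f hf hf'
  ext k
  have hle : (⨆ j ≠ i, finsuppGrading G deg j) ≤
      (⨆ j ≠ i - deg k, G j).comap (Finsupp.lapply k) := by
    refine iSup₂_le fun j hj g hg => ?_
    have hne : j - deg k ≠ i - deg k := by omega
    exact (le_iSup₂_of_le (f := fun j (_ : j ≠ i - deg k) => G j) _ hne le_rfl)
      (mem_finsuppGrading.1 hg k)
  exact (Submodule.disjoint_def.1 (indep (i - deg k))) _ (mem_finsuppGrading.1 hf k) (hle hf')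

end GradedSubmodules

theorem ksign_add (i j : ℤ) : ksign (i + j) = ksign i * ksign j := by
  simp [ksign, zpow_add]

theorem ksign_sub_one (i : ℤ) : ksign (i - 1) = -ksign i := by
  simp [ksign, zpow_sub]

variable {R : Type} [CommRing R] {A B E : DGAlgebra R}

/-- The differential of a DG algebra as a linear map. -/
def DGAlgebra.dLin (A : DGAlgebra R) : A.carrier →ₗ[R] A.carrier where
  toFun := A.d
  map_add' := A.d_add
  map_smul' := A.d_rsmul

/-- A homomorphism of DG algebras as a linear map. -/
def DGAlgHom.toLin (φ : DGAlgHom A B) : A.carrier →ₗ[R] B.carrier where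
  toFun := φ.toFun
  map_add' := φ.map_add
  map_smul' := φ.map_rsmul

namespace DGModule

/-- The differential of a DG module as a linear map. -/
def dLin (M : DGModule R A) : M.carrier →ₗ[R] M.carrier where
  toFun := M.d
  map_add' := M.d_add
  map_smul' := M.d_rsmul

/-- The action on a DG module as a bilinear map. -/
def smulLin (M : DGModule R A) : M.carrier →ₗ[R] A.carrier →ₗ[R] M.carrier :=
  LinearMap.mk₂ R M.smul M.add_smul M.rsmul_smul M.smul_add M.smul_rsmul

@[simp] theorem dLin_apply (M : DGModule R A) (x : M.carrier) : M.dLin x = M.d x := rfl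

@[simp] theorem smulLin_apply (M : DGModule R A) (x : M.carrier) (a : A.carrier) :
    M.smulLin x a = M.smul x a := rfl

theorem d_zero (M : DGModule R A) : M.d 0 = 0 := M.dLin.map_zero

theorem d_sub (M : DGModule R A) (x y : M.carrier) : M.d (x - y) = M.d x - M.d y :=
  M.dLin.map_sub x y

theorem d_neg (M : DGModule R A) (x : M.carrier) : M.d (-x) = -M.d x := M.dLin.map_neg x

theorem d_zsmul (M : DGModule R A) (n : ℤ) (x : M.carrier) : M.d (n • x) = n • M.d x :=
  map_zsmul M.dLin n x

theorem mem_iSup_grading (M : DGModule R A) (x : M.carrier) : x ∈ ⨆ i, M.grading i :=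
  M.spanning ▸ Submodule.mem_top

theorem homogeneous_induction (M : DGModule R A) {p : M.carrier → Prop} (x : M.carrier)
    (hom : ∀ i, ∀ x ∈ M.grading i, p x) (add : ∀ x y, p x → p y → p (x + y)) : p x :=
  Submodule.iSup_induction _ (motive := p) (M.mem_iSup_grading x) hom
    (hom 0 0 (zero_mem _)) add

end DGModule

theorem DGAlgebra.homogeneous_induction (A : DGAlgebra R) {p : A.carrier → Prop} (x : A.carrier)
    (hom : ∀ i, ∀ x ∈ A.grading i, p x) (add : ∀ x y, p x → p y → p (x + y)) : p x :=
  Submodule.iSup_induction _ (motive := p) (A.spanning ▸ Submodule.mem_top) hom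
    (hom 0 0 (zero_mem _)) add

/-- A homomorphism of DG modules as a linear map. -/
def DGHom.toLin {M N : DGModule R A} (f : DGHom M N) : M.carrier →ₗ[R] N.carrier where
  toFun := f.toFun
  map_add' := f.map_add
  map_smul' := f.map_rsmul

@[simp] theorem DGHom.toLin_apply {M N : DGModule R A} (f : DGHom M N) (x : M.carrier) :
    f.toLin x = f.toFun x := rfl

/-- A graded homomorphism as a linear map. -/
def GradedHom.toLin {M N : DGModule R A} {k : ℤ} (f : GradedHom M N k) :
    M.carrier →ₗ[R] N.carrier where
  toFun := f.toFun
  map_add' := f.map_add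
  map_smul' := f.map_rsmul

@[simp] theorem GradedHom.toLin_apply {M N : DGModule R A} {k : ℤ} (f : GradedHom M N k)
    (x : M.carrier) : f.toLin x = f.toFun x := rfl

namespace DGSubmodule

variable {M : DGModule R A} (D : DGSubmodule M)

theorem proj_mem {π : ℤ → M.carrier →ₗ[R] M.carrier}
    (hself : ∀ i, ∀ x ∈ M.grading i, π i x = x)
    (hne : ∀ i j, i ≠ j → ∀ x ∈ M.grading j, π i x = 0) (i : ℤ) {x : M.carrier}
    (hx : x ∈ D.toSubmodule) : π i x ∈ D.toSubmodule := by
  have key : Submodule.span R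
      ((D.toSubmodule : Set M.carrier) ∩ ⋃ i : ℤ, (M.grading i : Set M.carrier)) ≤
      D.toSubmodule.comap (π i) := by
    rw [Submodule.span_le]
    rintro y ⟨hy, hy'⟩
    obtain ⟨j, hj⟩ := Set.mem_iUnion.1 hy'
    by_cases h : i = j
    · subst h
      simpa [hself i y hj] using hy
    · simp [hne i j h y hj]
  exact key (D.graded' x hx)

/-- The quotient of a DG module by a DG submodule. -/
def quotient : DGModule R A where
  carrier := M.carrier ⧸ D.toSubmodule
  grading i := (M.grading i).map D.toSubmodule.mkQ
  indep := by
    obtain ⟨π, -, hself, hne⟩ := exists_graded_projections M.indep M.spanning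
    refine graded_indep_of_projections
      (fun i => D.toSubmodule.mapQ D.toSubmodule (π i) fun x hx => D.proj_mem hself hne i hx) ?_ ?_
    · rintro i _ ⟨x, hx, rfl⟩
      simp [hself i x hx]
    · rintro i j hij _ ⟨x, hx, rfl⟩
      simp [hne i j hij x hx]
  spanning := by
    rw [← Submodule.map_iSup, M.spanning, Submodule.map_top, Submodule.range_mkQ]
  smul x a := D.toSubmodule.mapQ D.toSubmodule (M.smulLin.flip a)
    (fun y hy => D.smul_mem' y a hy) x
  smul_add := by
    rintro ⟨m⟩ a b
    exact congrArg D.toSubmodule.mkQ (M.smul_add m a b)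
  add_smul x y a := map_add _ x y
  smul_rsmul := by
    rintro r ⟨m⟩ a
    exact congrArg D.toSubmodule.mkQ (M.smul_rsmul r m a)
  rsmul_smul r x a := map_smul _ r x
  smul_one := by
    rintro ⟨m⟩
    exact congrArg D.toSubmodule.mkQ (M.smul_one m)
  smul_mul := by
    rintro ⟨m⟩ a b
    exact congrArg D.toSubmodule.mkQ (M.smul_mul m a b)
  smul_mem := by
    rintro i j _ a ⟨m, hm, rfl⟩ ha
    exact ⟨_, M.smul_mem hm ha, rfl⟩
  d x := D.toSubmodule.mapQ D.toSubmodule M.dLin (fun y hy => D.d_mem' y hy) x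
  d_add x y := map_add _ x y
  d_rsmul r x := map_smul _ r x
  d_mem := by
    rintro i _ ⟨m, hm, rfl⟩
    exact ⟨_, M.d_mem hm, rfl⟩
  d_sq := by
    rintro ⟨m⟩
    exact congrArg D.toSubmodule.mkQ (M.d_sq m)
  leibniz := by
    rintro i _ a ⟨m, hm, rfl⟩
    exact (congrArg D.toSubmodule.mkQ (M.leibniz m a hm)).trans (by simp; rfl)

/-- The projection onto the quotient by a DG submodule. -/
def proj : DGHom M D.quotient where
  toFun := D.toSubmodule.mkQ
  map_add _ _ := rfl
  map_rsmul _ _ := rfl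
  map_smul _ _ := rfl
  map_mem hx := ⟨_, hx, rfl⟩
  comm_d _ := rfl

theorem proj_surjective : Function.Surjective D.proj.toFun := D.toSubmodule.mkQ_surjective

theorem proj_eq_zero {x : M.carrier} : D.proj.toFun x = 0 ↔ x ∈ D.toSubmodule :=
  Submodule.Quotient.mk_eq_zero _

/-- A DG homomorphism vanishing on a DG submodule factors through the quotient. -/
def lift {W : DGModule R A} (f : DGHom M W) (hf : ∀ x ∈ D.toSubmodule, f.toFun x = 0) :
    DGHom D.quotient W where
  toFun := D.toSubmodule.liftQ f.toLin hf
  map_add := map_add (D.toSubmodule.liftQ f.toLin hf)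
  map_rsmul := map_smul (D.toSubmodule.liftQ f.toLin hf)
  map_smul := by
    rintro ⟨x⟩ a
    exact f.map_smul x a
  map_mem := by
    rintro i _ ⟨x, hx, rfl⟩
    exact f.map_mem hx
  comm_d := by
    rintro ⟨x⟩
    exact f.comm_d x

end DGSubmodule

/-- The image of a homomorphism of DG modules. -/
def DGHom.range {M N : DGModule R A} (f : DGHom M N) : DGSubmodule N where
  toSubmodule := LinearMap.range f.toLin
  smul_mem' := by
    rintro _ a ⟨x, rfl⟩
    exact ⟨M.smul x a, f.map_smul x a⟩
  d_mem' := by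
    rintro _ ⟨x, rfl⟩
    exact ⟨M.d x, f.comm_d x⟩
  graded' := by
    rintro _ ⟨x, rfl⟩
    induction x using M.homogeneous_induction with
    | hom i x hx =>
      exact Submodule.subset_span ⟨⟨x, rfl⟩, Set.mem_iUnion.2 ⟨i, f.map_mem hx⟩⟩
    | add x y hx hy =>
      rw [_root_.map_add]
      exact add_mem hx hy

theorem DGHom.mem_grading_of_injective {M N : DGModule R A} (f : DGHom M N)
    (hf : Function.Injective f.toFun) {i : ℤ} {x : M.carrier} (hx : f.toFun x ∈ N.grading i) :
    x ∈ M.grading i := by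
  obtain ⟨π, hmem, hself, hne⟩ := exists_graded_projections M.indep M.spanning
  obtain ⟨ρ, -, hself', hne'⟩ := exists_graded_projections N.indep N.spanning
  have key : ∀ y, f.toLin (π i y) = ρ i (f.toLin y) := fun y => by
    induction y using M.homogeneous_induction with
    | hom j y hy =>
      by_cases h : i = j
      · subst h
        rw [hself i y hy, f.toLin_apply, hself' i _ (f.map_mem hy)]
      · rw [hne i j h y hy, f.toLin_apply y, hne' i j h _ (f.map_mem hy), map_zero]
    | add x y hx hy => simp only [_root_.map_add, hx, hy]
  have hx' : π i x = x := hf ((key x).trans (hself' i _ hx))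
  exact hx' ▸ hmem i x

namespace SemifreeBasisOn

variable {N : DGModule R B} {κ : Type} {e : κ → N.carrier}

/-- Coordinates with respect to a semifree basis. -/
noncomputable def coord (sb : SemifreeBasisOn N e) : N.carrier ≃ₗ[R] (κ →₀ B.carrier) :=
  (LinearEquiv.ofBijective (Finsupp.lsum R fun k => N.smulLin (e k)) sb.basis).symm

theorem coord_symm_single (sb : SemifreeBasisOn N e) (k : κ) (b : B.carrier) :
    sb.coord.symm (Finsupp.single k b) = N.smul (e k) b :=
  Finsupp.lsum_single R (fun k => N.smulLin (e k)) k b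

theorem coord_smul_basis (sb : SemifreeBasisOn N e) (k : κ) (b : B.carrier) :
    sb.coord (N.smul (e k) b) = Finsupp.single k b := by
  rw [← sb.coord_symm_single, LinearEquiv.apply_symm_apply]

theorem coord_basis (sb : SemifreeBasisOn N e) (k : κ) :
    sb.coord (e k) = Finsupp.single k 1 := by
  rw [← sb.coord_smul_basis, N.smul_one]

theorem induction_on (sb : SemifreeBasisOn N e) {p : N.carrier → Prop} (n : N.carrier)
    (add : ∀ x y, p x → p y → p (x + y)) (zero : p 0)
    (basis : ∀ k b, p (N.smul (e k) b)) : p n := by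
  obtain ⟨c, rfl⟩ := sb.coord.symm.surjective n
  induction c using Finsupp.induction_linear with
  | zero => rwa [map_zero]
  | add f g hf hg =>
    rw [map_add]
    exact add _ _ hf hg
  | single k b =>
    rw [sb.coord_symm_single]
    exact basis k b

theorem coord_smul (sb : SemifreeBasisOn N e) (n : N.carrier) (b : B.carrier) (k : κ) :
    sb.coord (N.smul n b) k = sb.coord n k * b := by
  classical
  induction n using sb.induction_on with
  | add x y hx hy => simp [N.add_smul, hx, hy, add_mul]
  | zero =>
    have h : N.smul 0 b = 0 := (N.smulLin.flip b).map_zero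
    simp [h]
  | basis j c =>
    rw [N.smul_mul, sb.coord_smul_basis, sb.coord_smul_basis, Finsupp.single_apply,
      Finsupp.single_apply]
    split_ifs <;> simp

theorem coord_mem (sb : SemifreeBasisOn N e) {i : ℤ} {n : N.carrier} (hn : n ∈ N.grading i)
    (k : κ) : sb.coord n k ∈ B.grading (i - sb.deg k) := by
  have h := graded_le_of_le (G := N.grading)
    (G' := fun i => (finsuppGrading B.grading sb.deg i).map sb.coord.symm.toLinearMap) N.indep
    (by
      rw [← Submodule.map_iSup, finsuppGrading_spanning B.spanning, Submodule.map_top]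
      exact LinearEquiv.range _)
    (by
      rintro i _ ⟨c, hc, rfl⟩
      change sb.coord.symm c ∈ _
      rw [← c.sum_single, Finsupp.sum, map_sum]
      refine sum_mem fun k _ => ?_
      rw [sb.coord_symm_single]
      have := N.smul_mem (sb.homog k) (mem_finsuppGrading.1 hc k)
      rwa [add_sub_cancel] at this) i
  obtain ⟨c, hc, rfl⟩ := h hn
  simpa using mem_finsuppGrading.1 hc k

theorem homogeneous_induction_on (sb : SemifreeBasisOn N e) {p : N.carrier → Prop} {i : ℤ}
    {n : N.carrier} (hn : n ∈ N.grading i) (zero : p 0)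
    (add : ∀ x y, p x → p y → p (x + y))
    (basis : ∀ k, ∀ b ∈ B.grading (i - sb.deg k), p (N.smul (e k) b)) : p n := by
  classical
  have h : n = ∑ k ∈ (sb.coord n).support, N.smul (e k) (sb.coord n k) := by
    apply sb.coord.injective
    simp only [map_sum, sb.coord_smul_basis]
    exact (Finsupp.sum_single _).symm
  rw [h]
  exact Finset.sum_induction _ p add zero fun k _ => basis k _ (sb.coord_mem hn k)

/-- Graded homomorphisms out of a semifree DG module lift along surjections onto quotients. -/
theorem exists_lift (sb : SemifreeBasisOn N e) {P : DGModule R B} (D : DGSubmodule P) {s : ℤ}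
    (f : GradedHom N D.quotient s) :
    ∃ g : GradedHom N P s, ∀ x, D.proj.toFun (g.toFun x) = f.toFun x := by
  have hk : ∀ k, ∃ p ∈ P.grading (sb.deg k + s), D.proj.toFun p = f.toFun (e k) :=
    fun k => f.map_mem (sb.homog k)
  choose p hp hpf using hk
  let L : N.carrier →ₗ[R] P.carrier :=
    (Finsupp.lsum R fun k => P.smulLin (p k)) ∘ₗ sb.coord.toLinearMap
  have hL : ∀ k b, L (N.smul (e k) b) = P.smul (p k) b := fun k b => by
    simp only [L, LinearMap.comp_apply, LinearEquiv.coe_coe, sb.coord_smul_basis]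
    exact Finsupp.lsum_single R (fun k => P.smulLin (p k)) k b
  have hLs : ∀ x a, L (N.smul x a) = P.smul (L x) a := fun x a => by
    induction x using sb.induction_on with
    | add x y hx hy => rw [N.add_smul, map_add, map_add, P.add_smul, hx, hy]
    | zero =>
      have h : N.smul 0 a = 0 := (N.smulLin.flip a).map_zero
      have h' : P.smul 0 a = 0 := (P.smulLin.flip a).map_zero
      rw [h, map_zero, h']
    | basis k b => rw [N.smul_mul, hL, hL, P.smul_mul]
  refine ⟨⟨L, map_add L, map_smul L, hLs, fun {i x} hx => ?_⟩, fun x => ?_⟩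
  · refine sb.homogeneous_induction_on (p := fun x => L x ∈ P.grading (i + s)) hx ?_ ?_ ?_
    · rw [map_zero]
      exact zero_mem _
    · intro x y hx hy
      rw [map_add]
      exact add_mem hx hy
    · intro k b hb
      rw [hL]
      have := P.smul_mem (hp k) hb
      rwa [show sb.deg k + s + (i - sb.deg k) = i + s by ring] at this
  · change D.proj.toLin (L x) = f.toLin x
    induction x using sb.induction_on with
    | add x y hx hy => rw [map_add, map_add, map_add, hx, hy]
    | zero => rw [map_zero, map_zero, map_zero]
    | basis k b =>
      rw [hL]
      exact (D.proj.map_smul _ _).trans ((congrArg (D.quotient.smul · b) (hpf k)).trans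
        (f.map_smul _ _).symm)

variable {φ : DGAlgHom A B}

/-- The map `(n, x) ↦ n ⊗ x` in coordinates, from `N × B^e` to the model `⨁ₖ eₖ ⊗ B^e` of
`N ⊗_B B^e`. -/
noncomputable def tmul (sb : SemifreeBasisOn N e) (he : EnvelopingAlg φ E) :
    N.carrier →ₗ[R] E.carrier →ₗ[R] (κ →₀ E.carrier) :=
  LinearMap.mk₂ R
    (fun n x => Finsupp.mapRange.linearMap
      ((LinearMap.mulRight R x) ∘ₗ he.l.toLin) (sb.coord n))
    (fun n n' x => by simp only [map_add])
    (fun r n x => by simp only [map_smul])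
    (fun n x y => by ext k; simp [mul_add])
    (fun r n x => by ext k; simp)

theorem tmul_apply (sb : SemifreeBasisOn N e) (he : EnvelopingAlg φ E) (n : N.carrier)
    (x : E.carrier) (k : κ) : sb.tmul he n x k = he.l.toFun (sb.coord n k) * x := by
  simp [tmul]
  rfl

theorem tmul_smul (sb : SemifreeBasisOn N e) (he : EnvelopingAlg φ E) (n : N.carrier)
    (b : B.carrier) (x : E.carrier) :
    sb.tmul he (N.smul n b) x = sb.tmul he n (he.l.toFun b * x) := by
  ext k
  rw [tmul_apply, tmul_apply, coord_smul, he.l.map_mul, mul_assoc]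

theorem tmul_basis (sb : SemifreeBasisOn N e) (he : EnvelopingAlg φ E) (k : κ)
    (x : E.carrier) : sb.tmul he (e k) x = Finsupp.single k x := by
  classical
  ext j
  rw [tmul_apply, sb.coord_basis, Finsupp.single_apply, Finsupp.single_apply]
  split_ifs
  · rw [he.l.map_one, one_mul]
  · rw [show he.l.toFun 0 = 0 from he.l.toLin.map_zero, zero_mul]

theorem tmul_mem (sb : SemifreeBasisOn N e) (he : EnvelopingAlg φ E) {i j : ℤ}
    {n : N.carrier} {x : E.carrier} (hn : n ∈ N.grading i) (hx : x ∈ E.grading j) :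
    sb.tmul he n x ∈ finsuppGrading E.grading sb.deg (i + j) := by
  rw [mem_finsuppGrading]
  intro k
  rw [tmul_apply]
  have := E.mul_mem (he.l.map_mem (sb.coord_mem hn k)) hx
  rwa [show i - sb.deg k + j = i + j - sb.deg k by ring] at this

/-- The differential of the model `⨁ₖ eₖ ⊗ B^e` of `N ⊗_B B^e`. -/
noncomputable def tensorD (sb : SemifreeBasisOn N e) (he : EnvelopingAlg φ E) :
    (κ →₀ E.carrier) →ₗ[R] (κ →₀ E.carrier) :=
  Finsupp.lsum R fun k =>
    sb.tmul he (N.d (e k)) + ksign (sb.deg k) • (sb.tmul he (e k) ∘ₗ E.dLin)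

theorem tensorD_single (sb : SemifreeBasisOn N e) (he : EnvelopingAlg φ E) (k : κ)
    (x : E.carrier) :
    sb.tensorD he (Finsupp.single k x) =
      sb.tmul he (N.d (e k)) x + ksign (sb.deg k) • sb.tmul he (e k) (E.d x) :=
  Finsupp.lsum_single R _ k x

theorem tensorD_tmul (sb : SemifreeBasisOn N e) (he : EnvelopingAlg φ E) {i : ℤ}
    {n : N.carrier} (hn : n ∈ N.grading i) (x : E.carrier) :
    sb.tensorD he (sb.tmul he n x) =
      sb.tmul he (N.d n) x + ksign i • sb.tmul he n (E.d x) := by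
  refine sb.homogeneous_induction_on (p := fun n => sb.tensorD he (sb.tmul he n x) =
    sb.tmul he (N.d n) x + ksign i • sb.tmul he n (E.d x)) hn ?_ ?_ ?_
  · simp [N.d_zero]
  · intro n n' h h'
    simp only [map_add, N.d_add, LinearMap.add_apply, h, h', smul_add]
    abel
  · intro k b hb
    rw [N.leibniz _ _ (sb.homog k), tmul_smul, tmul_basis, tensorD_single,
      E.leibniz _ _ (he.l.map_mem hb), map_add, map_add, LinearMap.add_apply, tmul_smul,
      map_zsmul, map_zsmul, LinearMap.smul_apply, tmul_smul, tmul_smul, smul_add, smul_smul,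
      ← ksign_add, add_sub_cancel, he.l.comm_d, add_assoc]

/-- The model `⨁ₖ eₖ ⊗ B^e` of the DG module `N ⊗_B B^e` for a semifree `N`. -/
noncomputable def tensorModel (sb : SemifreeBasisOn N e) (he : EnvelopingAlg φ E) :
    DGModule R B where
  carrier := κ →₀ E.carrier
  grading := finsuppGrading E.grading sb.deg
  indep := finsuppGrading_indep E.indep sb.deg
  spanning := finsuppGrading_spanning E.spanning sb.deg
  smul f b := Finsupp.mapRange.linearMap (LinearMap.mulRight R (he.r.toFun b)) f
  smul_add f a b := by
    ext k
    simp [he.r.map_add, mul_add]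
  add_smul f g b := map_add _ f g
  smul_rsmul r f b := by
    ext k
    simp [he.r.map_rsmul]
  rsmul_smul r f b := map_smul _ r f
  smul_one f := by
    ext k
    simp [he.r.map_one]
  smul_mul f a b := by
    ext k
    simp [he.r.map_mul, mul_assoc]
  smul_mem {i j f b} hf hb := by
    rw [mem_finsuppGrading] at hf ⊢
    intro k
    have := E.mul_mem (hf k) (he.r.map_mem hb)
    rw [show i - sb.deg k + j = i + j - sb.deg k by ring] at this
    simpa using this
  d := sb.tensorD he
  d_add := map_add _
  d_rsmul := map_smul _
  d_mem {i f} hf := by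
    rw [← f.sum_single, Finsupp.sum, map_sum]
    refine sum_mem fun k _ => ?_
    have hk := mem_finsuppGrading.1 hf k
    rw [tensorD_single]
    have h₁ := sb.tmul_mem he (N.d_mem (sb.homog k)) hk
    have h₂ := sb.tmul_mem he (sb.homog k) (E.d_mem hk)
    rw [show sb.deg k - 1 + (i - sb.deg k) = i - 1 by ring] at h₁
    rw [show sb.deg k + (i - sb.deg k - 1) = i - 1 by ring] at h₂
    exact add_mem h₁ (zsmul_mem h₂ _)
  d_sq f := by
    induction f using Finsupp.induction_linear with
    | zero => rw [map_zero, map_zero]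
    | add f g hf hg => rw [map_add, map_add, hf, hg, add_zero]
    | single k x =>
      rw [tensorD_single, map_add, map_zsmul, sb.tensorD_tmul he (N.d_mem (sb.homog k)),
        sb.tensorD_tmul he (sb.homog k), N.d_sq, E.d_sq, ksign_sub_one]
      simp
  leibniz {i} f b hf := by
    rw [← f.sum_single, Finsupp.sum]
    simp only [map_sum, Finset.smul_sum, ← Finset.sum_add_distrib]
    refine Finset.sum_congr rfl fun k _ => ?_
    have hk := mem_finsuppGrading.1 hf k
    have hr : ∀ n x c, Finsupp.mapRange.linearMap (LinearMap.mulRight R (he.r.toFun c))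
        (sb.tmul he n x) = sb.tmul he n (x * he.r.toFun c) := fun n x c => by
      ext j
      simp [tmul_apply, mul_assoc]
    rw [← sb.tmul_basis he k (f k), hr, hr, sb.tensorD_tmul he (sb.homog k),
      sb.tensorD_tmul he (sb.homog k), map_add, map_zsmul, hr, hr, E.leibniz _ _ hk, map_add,
      map_zsmul, smul_add, smul_smul, ← ksign_add, add_sub_cancel, he.r.comm_d, add_assoc]

/-- The tautological pairing into the model of `N ⊗_B B^e`. -/
noncomputable def tensorModelPairing (sb : SemifreeBasisOn N e) (he : EnvelopingAlg φ E)
    (S : Set E.carrier) : TensorPairing φ he S ∅ N (sb.tensorModel he) where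
  pair n x := sb.tmul he n x
  add_left n n' x _ := by rw [map_add, LinearMap.add_apply]; rfl
  add_right n x y _ _ := map_add _ x y
  rsmul_left r n x _ := by rw [map_smul, LinearMap.smul_apply]; rfl
  rsmul_right r n x _ := map_smul _ r x
  balanced n b x _ := sb.tmul_smul he n b x
  act_right n b x _ := by
    refine Finsupp.ext fun k => ?_
    change _ = Finsupp.mapRange.linearMap (LinearMap.mulRight R (he.r.toFun b))
      (sb.tmul he n x) k
    simp [tmul_apply, mul_assoc]
  grade n x hn _ hx := sb.tmul_mem he hn hx
  chain n x hn _ := sb.tensorD_tmul he hn x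
  kill n x hx := hx.elim

end SemifreeBasisOn

/-- The composite of two homomorphisms of DG modules. -/
def DGHom.comp {M N W : DGModule R A} (g : DGHom N W) (f : DGHom M N) : DGHom M W where
  toFun x := g.toFun (f.toFun x)
  map_add x y := by rw [f.map_add, g.map_add]
  map_rsmul r x := by rw [f.map_rsmul, g.map_rsmul]
  map_smul x a := by rw [f.map_smul, g.map_smul]
  map_mem hx := g.map_mem (f.map_mem hx)
  comm_d x := by rw [f.comm_d, g.comm_d]

/-- The zero homomorphism of DG modules. -/
def DGHom.zero (M N : DGModule R A) : DGHom M N where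
  toFun _ := 0
  map_add _ _ := (add_zero 0).symm
  map_rsmul r _ := (smul_zero r).symm
  map_smul _ a := (N.smulLin.flip a).map_zero.symm
  map_mem _ := zero_mem _
  comm_d _ := N.d_zero.symm

section Tensor

variable {φ : DGAlgHom A B} {he : EnvelopingAlg φ E} {S Z : Set E.carrier}
  {N P W : DGModule R B}

/-- The composite of a balanced pairing with a homomorphism of DG modules. -/
def TensorPairing.comp (γ : TensorPairing φ he S Z N P) (g : DGHom P W) :
    TensorPairing φ he S Z N W where
  pair n x := g.toFun (γ.pair n x)
  add_left n n' x hx := by rw [γ.add_left n n' x hx, g.map_add]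
  add_right n x y hx hy := by rw [γ.add_right n x y hx hy, g.map_add]
  rsmul_left r n x hx := by rw [γ.rsmul_left r n x hx, g.map_rsmul]
  rsmul_right r n x hx := by rw [γ.rsmul_right r n x hx, g.map_rsmul]
  balanced n b x hx := by rw [γ.balanced n b x hx]
  act_right n b x hx := by rw [γ.act_right n b x hx, g.map_smul]
  grade n x hn hx hx' := g.map_mem (γ.grade n x hn hx hx')
  chain {i} n x hn hx := by
    rw [← g.comm_d, γ.chain n x hn hx, g.map_add]
    exact congrArg _ (map_zsmul g.toLin (ksign i) _)
  kill n x hx := by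
    rw [γ.kill n x hx]
    exact g.toLin.map_zero

/-- A balanced pairing regarded as killing a subset on which it vanishes. -/
def TensorPairing.changeKill (γ : TensorPairing φ he S Z N P) (Z' : Set E.carrier)
    (h : ∀ n x, x ∈ Z' → γ.pair n x = 0) : TensorPairing φ he S Z' N P :=
  { γ with kill := h }

theorem IsTensorSubquot.hom_ext (hP : IsTensorSubquot φ he S Z N P) {g g' : DGHom P W}
    (h : ∀ n x, x ∈ S → g.toFun (hP.pairing.pair n x) = g'.toFun (hP.pairing.pair n x))
    (p : P.carrier) : g.toFun p = g'.toFun p := by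
  obtain ⟨f, -, hf⟩ := hP.univ W (hP.pairing.comp g')
  rw [hf g h p, hf g' (fun _ _ _ => rfl) p]

/-- The cokernel of `N ⊗ S' → N ⊗ S` is `N ⊗ (S / S')`. -/
theorem IsTensorSubquot.exists_quotient {S' : Set E.carrier} {P' : DGModule R B}
    (hS : S' ⊆ S) (hP' : IsTensorSubquot φ he S' ∅ N P') (hP : IsTensorSubquot φ he S ∅ N P)
    (j : DGHom P' P)
    (hj : ∀ n x, x ∈ S' → j.toFun (hP'.pairing.pair n x) = hP.pairing.pair n x) :
    Nonempty (IsTensorSubquot φ he S S' N j.range.quotient) := by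
  refine ⟨⟨(hP.pairing.comp j.range.proj).changeKill S' fun n x hx => ?_, fun W γ => ?_⟩⟩
  · exact j.range.proj_eq_zero.2 ⟨_, hj n x hx⟩
  · obtain ⟨g, hg, -⟩ := hP.univ W (γ.changeKill ∅ fun _ _ h => h.elim)
    have hz : ∀ x ∈ j.range.toSubmodule, g.toFun x = 0 := by
      rintro _ ⟨y, rfl⟩
      refine hP'.hom_ext (g := g.comp j) (g' := DGHom.zero _ _) (fun n x hx => ?_) y
      change g.toFun (j.toFun _) = 0
      rw [hj n x hx, hg n x (hS hx)]
      exact γ.kill n x hx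
    refine ⟨j.range.lift g hz, hg, fun g' hg' p => ?_⟩
    obtain ⟨p, rfl⟩ := j.range.proj_surjective p
    exact hP.hom_ext (g := g'.comp j.range.proj) (g' := g)
      (fun n x hx => (hg' n x hx).trans (hg n x hx).symm) p

end Tensor

section Generators

variable {φ : DGAlgHom A B} {he : EnvelopingAlg φ E} {πB : DGAlgHom E B}

/-- The filtration step `J^[ℓ]` as a submodule. -/
def QuasiSmoothData.filtSubmodule (qs : QuasiSmoothData φ E he πB) (ℓ : ℕ) :
    Submodule R E.carrier where
  carrier := qs.filt ℓ
  add_mem' hx hy := qs.filt_add ℓ _ _ hx hy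
  zero_mem' := qs.filt_zero ℓ
  smul_mem' r x hx := qs.filt_rsmul ℓ r x hx

theorem QuasiSmoothData.filt_induction (qs : QuasiSmoothData φ E he πB) (ℓ : ℕ)
    {p : E.carrier → Prop} {x : E.carrier} (hx : x ∈ qs.filt ℓ)
    (hom : ∀ i, ∀ x ∈ E.grading i, x ∈ qs.filt ℓ → p x)
    (add : ∀ x y, x ∈ qs.filt ℓ → y ∈ qs.filt ℓ → p x → p y → p (x + y)) : p x := by
  have key : x ∈ qs.filt ℓ ∧ p x := by
    have hspan := qs.filt_graded ℓ x hx
    clear hx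
    induction hspan using Submodule.closure_induction with
    | zero => exact ⟨qs.filt_zero ℓ, hom 0 0 (zero_mem _) (qs.filt_zero ℓ)⟩
    | add x y _ _ hx hy => exact ⟨qs.filt_add ℓ x y hx.1 hy.1, add x y hx.1 hy.1 hx.2 hy.2⟩
    | smul_mem r x hx =>
      obtain ⟨i, hi⟩ := Set.mem_iUnion.1 hx.2
      have h := qs.filt_rsmul ℓ r x hx.1
      exact ⟨h, hom i _ (Submodule.smul_mem _ r hi) h⟩
  exact key.2

theorem QuasiSmoothData.mul_mem_filt (qs : QuasiSmoothData φ E he πB) (ℓ : ℕ) (a : E.carrier)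
    {x : E.carrier} (hx : x ∈ qs.filt ℓ) : a * x ∈ qs.filt ℓ := by
  refine qs.filt_induction ℓ (p := fun x => a * x ∈ qs.filt ℓ) hx (fun i x hi hx => ?_)
    fun x y _ _ h h' => ?_
  · induction a using E.homogeneous_induction with
    | hom j a ha =>
      rw [E.gcomm a x ha hi]
      exact zsmul_mem (show x * a ∈ qs.filtSubmodule ℓ from qs.filt_act ℓ a x hx) _
    | add a b h h' =>
      rw [add_mul]
      exact qs.filt_add ℓ _ _ h h'
  · rw [mul_add]
    exact qs.filt_add ℓ _ _ h h'

variable {N P : DGModule R B} (qs : QuasiSmoothData φ E he πB) {ℓ : ℕ}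

/-- The DG submodule spanned by the elementary tensors. -/
def TensorPairing.span (γ : TensorPairing φ he (qs.filt ℓ) ∅ N P) : DGSubmodule P where
  toSubmodule := Submodule.span R {y | ∃ n, ∃ x ∈ qs.filt ℓ, y = γ.pair n x}
  smul_mem' y b hy := by
    have key : Submodule.span R {y | ∃ n, ∃ x ∈ qs.filt ℓ, y = γ.pair n x} ≤
        (Submodule.span R {y | ∃ n, ∃ x ∈ qs.filt ℓ, y = γ.pair n x}).comap
          (P.smulLin.flip b) := by
      rw [Submodule.span_le]
      rintro _ ⟨n, x, hx, rfl⟩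
      exact Submodule.subset_span ⟨n, x * he.r.toFun b, qs.filt_act ℓ _ x hx,
        (γ.act_right n b x hx).symm⟩
    exact key hy
  d_mem' y hy := by
    have key : Submodule.span R {y | ∃ n, ∃ x ∈ qs.filt ℓ, y = γ.pair n x} ≤
        (Submodule.span R {y | ∃ n, ∃ x ∈ qs.filt ℓ, y = γ.pair n x}).comap P.dLin := by
      rw [Submodule.span_le]
      rintro _ ⟨n, x, hx, rfl⟩
      rw [SetLike.mem_coe, Submodule.mem_comap, P.dLin_apply]
      induction n using N.homogeneous_induction with
      | hom i n hn =>
        rw [γ.chain n x hn hx]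
        have h : γ.pair n (E.d x) ∈
            Submodule.span R {y | ∃ n, ∃ x ∈ qs.filt ℓ, y = γ.pair n x} :=
          Submodule.subset_span ⟨n, _, qs.filt_d ℓ x hx, rfl⟩
        exact add_mem (Submodule.subset_span ⟨_, x, hx, rfl⟩) (zsmul_mem h _)
      | add n n' h h' =>
        rw [γ.add_left n n' x hx, P.d_add]
        exact add_mem h h'
    exact key hy
  graded' y hy := by
    refine Submodule.span_le.2 ?_ hy
    rintro _ ⟨n, x, hx, rfl⟩
    refine qs.filt_induction ℓ (p := fun x => γ.pair n x ∈ Submodule.span R _) hx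
      (fun j x hj hx => ?_) fun x y hx hy h h' => ?_
    · induction n using N.homogeneous_induction with
      | hom i n hn =>
        exact Submodule.subset_span ⟨Submodule.subset_span ⟨n, x, hx, rfl⟩,
          Set.mem_iUnion.2 ⟨i + j, γ.grade n x hn hx hj⟩⟩
      | add n n' h h' =>
        rw [γ.add_left n n' x hx]
        exact add_mem h h'
    · rw [γ.add_right n x y hx hy]
      exact add_mem h h'

theorem IsTensorSubquot.mem_span (hP : IsTensorSubquot φ he (qs.filt ℓ) ∅ N P)
    (p : P.carrier) : p ∈ (hP.pairing.span qs).toSubmodule := by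
  rw [← DGSubmodule.proj_eq_zero]
  exact hP.hom_ext (g := (hP.pairing.span qs).proj) (g' := DGHom.zero _ _)
    (fun n x hx => (DGSubmodule.proj_eq_zero _).2 (Submodule.subset_span ⟨n, x, hx, rfl⟩)) p

/-- The map `x ↦ n ⊗ x` on `J^[ℓ]` as a linear map. -/
def TensorPairing.pairLin (γ : TensorPairing φ he (qs.filt ℓ) ∅ N P) (n : N.carrier) :
    qs.filtSubmodule ℓ →ₗ[R] P.carrier where
  toFun x := γ.pair n x
  map_add' x y := γ.add_right n x y x.2 y.2
  map_smul' r x := γ.rsmul_right r n x x.2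

/-- The canonical map from `N ⊗_B J^[ℓ]` to the model of `N ⊗_B B^e` is injective. -/
theorem IsTensorSubquot.injective_toModel (hP : IsTensorSubquot φ he (qs.filt ℓ) ∅ N P)
    {κ : Type} {e : κ → N.carrier} (sb : SemifreeBasisOn N e)
    (u : DGHom P (sb.tensorModel he))
    (hu : ∀ n x, x ∈ qs.filt ℓ → u.toFun (hP.pairing.pair n x) = sb.tmul he n x) :
    Function.Injective u.toFun := by
  let ψ : (κ →₀ qs.filtSubmodule ℓ) →ₗ[R] P.carrier :=
    Finsupp.lsum R fun k => hP.pairing.pairLin qs (e k)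
  have hψ : ∀ k x, ψ (Finsupp.single k x) = hP.pairing.pair (e k) x := fun k x =>
    Finsupp.lsum_single R (fun k => hP.pairing.pairLin qs (e k)) k x
  have hsurj : ∀ p, p ∈ LinearMap.range ψ := fun p => by
    refine Submodule.span_le.2 ?_ (hP.mem_span qs p)
    rintro _ ⟨n, x, hx, rfl⟩
    rw [SetLike.mem_coe]
    induction n using sb.induction_on with
    | add n n' h h' =>
      rw [hP.pairing.add_left n n' x hx]
      exact add_mem h h'
    | zero =>
      have h := hP.pairing.rsmul_left 0 0 x hx
      rw [zero_smul, zero_smul] at h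
      rw [h]
      exact zero_mem _
    | basis k b =>
      rw [hP.pairing.balanced _ b x hx]
      exact ⟨Finsupp.single k ⟨_, qs.mul_mem_filt ℓ _ hx⟩, hψ _ _⟩
  have huψ : ∀ c, u.toLin (ψ c) =
      Finsupp.mapRange.linearMap (qs.filtSubmodule ℓ).subtype c := fun c => by
    induction c using Finsupp.induction_linear with
    | zero => rw [map_zero, map_zero, map_zero]; rfl
    | add c c' h h' => rw [map_add, map_add, map_add, h, h']; rfl
    | single k x =>
      rw [hψ]
      refine (hu _ _ x.2).trans ((sb.tmul_basis he k x).trans ?_)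
      simp
  refine (injective_iff_map_eq_zero u.toLin).2 fun p hp => ?_
  obtain ⟨c, rfl⟩ := hsurj p
  rw [huψ] at hp
  have hc : c = 0 :=
    Finsupp.mapRange_injective _ rfl Subtype.val_injective
      (hp.trans (Finsupp.mapRange.linearMap (qs.filtSubmodule ℓ).subtype).map_zero.symm)
  rw [hc, map_zero]

end Generators

/-- If `N` is semifree, tensoring preserves the injectivity of `J^[ℓ] ↪ J^[m]`. -/
theorem IsTensorSubquot.injective_of_semifree {φ : DGAlgHom A B} {he : EnvelopingAlg φ E}
    {πB : DGAlgHom E B} (qs : QuasiSmoothData φ E he πB) {ℓ m : ℕ}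
    (hle : qs.filt ℓ ⊆ qs.filt m) {N P' P : DGModule R B} (hsf : IsSemifree N)
    (hP' : IsTensorSubquot φ he (qs.filt ℓ) ∅ N P')
    (hP : IsTensorSubquot φ he (qs.filt m) ∅ N P) (j : DGHom P' P)
    (hj : ∀ n x, x ∈ qs.filt ℓ → j.toFun (hP'.pairing.pair n x) = hP.pairing.pair n x) :
    Function.Injective j.toFun := by
  obtain ⟨κ, e, ⟨sb⟩⟩ := hsf
  obtain ⟨u, hu, -⟩ := hP.univ _ (sb.tensorModelPairing he _)
  have := hP'.injective_toModel qs sb (u.comp j) fun n x hx => by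
    change u.toFun (j.toFun _) = _
    rw [hj n x hx, hu n x (hle hx)]
    rfl
  exact Function.Injective.of_comp this

namespace GradedHom

variable {N M M' : DGModule R A} {k : ℤ}

/-- The composite of a graded homomorphism with a homomorphism of DG modules. -/
def compDGHom (f : GradedHom N M k) (g : DGHom M M') : GradedHom N M' k where
  toFun x := g.toFun (f.toFun x)
  map_add x y := by rw [f.map_add, g.map_add]
  map_rsmul r x := by rw [f.map_rsmul, g.map_rsmul]
  map_smul x a := by rw [f.map_smul, g.map_smul]
  map_mem hx := g.map_mem (f.map_mem hx)

/-- A graded homomorphism regarded as having a degree equal to the original one. -/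
def cast (f : GradedHom N M k) {l : ℤ} (h : k = l) : GradedHom N M l where
  toFun := f.toFun
  map_add := f.map_add
  map_rsmul := f.map_rsmul
  map_smul := f.map_smul
  map_mem hx := h ▸ f.map_mem hx

/-- The negative of a graded homomorphism. -/
def neg (f : GradedHom N M k) : GradedHom N M k where
  toFun x := -f.toFun x
  map_add x y := by rw [f.map_add, neg_add]
  map_rsmul r x := by rw [f.map_rsmul, smul_neg]
  map_smul x a := by
    rw [f.map_smul]
    exact (map_neg (M.smulLin.flip a) _).symm
  map_mem hx := neg_mem (f.map_mem hx)

theorem map_zero (f : GradedHom N M k) : f.toFun 0 = 0 := f.toLin.map_zero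

/-- Subtracting a coboundary from a graded homomorphism. -/
def subCoboundary (f : GradedHom N M (-k)) (h : GradedHom N M (-k + 1)) :
    GradedHom N M (-k) where
  toFun x := f.toFun x - (M.d (h.toFun x) + ksign k • h.toFun (N.d x))
  map_add x y := by
    rw [N.d_add, f.map_add, h.map_add, h.map_add, M.d_add, smul_add]
    abel
  map_rsmul r x := by
    rw [N.d_rsmul, f.map_rsmul, h.map_rsmul, h.map_rsmul, M.d_rsmul, smul_comm, smul_sub,
      smul_add]
  map_smul x a := by
    have hz : ∀ (n : ℤ) y, M.smul (n • y) a = n • M.smul y a := fun n y =>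
      map_zsmul (M.smulLin.flip a) n y
    have hs : ∀ y z, M.smul (y - z) a = M.smul y a - M.smul z a := fun y z =>
      map_sub (M.smulLin.flip a) y z
    rw [f.map_smul, hs, M.add_smul, hz]
    congr 1
    induction x using N.homogeneous_induction with
    | hom i x hx =>
      rw [h.map_smul, M.leibniz _ _ (h.map_mem hx), N.leibniz _ _ hx, h.map_add,
        h.map_smul, ← h.toLin_apply (ksign i • _), map_zsmul, h.toLin_apply, h.map_smul,
        smul_add, smul_smul, add_assoc]
      have hk : ksign (i + (-k + 1)) = -(ksign k * ksign i) := by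
        have h₁ : ksign (-k) = ksign k := by simp [ksign]
        rw [ksign_add, ksign_add, h₁]
        simp [ksign, mul_comm]
      rw [hk, neg_smul]
      abel
    | add x y hx hy =>
      simp only [N.add_smul, N.d_add, h.map_add, M.d_add, M.add_smul, smul_add] at *
      rw [add_add_add_comm, hx, hy]
      abel
  map_mem {i x} hx := by
    refine sub_mem (f.map_mem hx) (add_mem ?_ (zsmul_mem ?_ _))
    · have := M.d_mem (h.map_mem hx)
      rwa [show i + (-k + 1) - 1 = i + -k by ring] at this
    · have := h.map_mem (N.d_mem hx)
      rwa [show i - 1 + (-k + 1) = i + -k by ring] at this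

/-- A graded homomorphism landing in the image of an injective DG homomorphism factors
through it. -/
theorem exists_factor (f : GradedHom N M k) (j : DGHom M' M)
    (hj : Function.Injective j.toFun) (hf : ∀ x, f.toFun x ∈ j.range.toSubmodule) :
    ∃ g : GradedHom N M' k, ∀ x, j.toFun (g.toFun x) = f.toFun x := by
  choose g hg using hf
  replace hg : ∀ x, j.toFun (g x) = f.toFun x := hg
  refine ⟨⟨g, fun x y => hj ?_, fun r x => hj ?_, fun x a => hj ?_, fun hx => ?_⟩, hg⟩
  · rw [j.map_add, hg, hg, hg, f.map_add]
  · rw [j.map_rsmul, hg, hg, f.map_rsmul]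
  · rw [j.map_smul, hg, hg, f.map_smul]
  · refine j.mem_grading_of_injective hj ?_
    rw [hg]
    exact f.map_mem hx

end GradedHom

/-- A consequence of the long exact `Ext` sequence of `0 → M' → M → M/M' → 0`: if `Ext^{i-1}(N, M/M')` and
`Ext^i(N, M/M')` vanish then `Ext^i(N, M') ≅ Ext^i(N, M)`. -/
theorem inducesExtIso_of_injective {N M' M : DGModule R A} (hsf : IsSemifree N)
    (j : DGHom M' M) (hj : Function.Injective j.toFun) (i : ℤ)
    (h₁ : ExtVanish (i - 1) N j.range.quotient) (h₂ : ExtVanish i N j.range.quotient) :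
    InducesExtIso i N j := by
  obtain ⟨κ, e, ⟨sb⟩⟩ := hsf
  have hq : ∀ x, j.range.proj.toFun (j.toFun x) = 0 := fun x =>
    j.range.proj_eq_zero.2 ⟨x, rfl⟩
  have hjz : ∀ (n : ℤ) x, j.toFun (n • x) = n • j.toFun x := map_zsmul j.toLin
  have hqz : ∀ (n : ℤ) x, j.range.proj.toFun (n • x) = n • j.range.proj.toFun x :=
    map_zsmul j.range.proj.toLin
  have hqs : ∀ x y, j.range.proj.toFun (x - y) =
    j.range.proj.toFun x - j.range.proj.toFun y := map_sub j.range.proj.toLin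
  refine ⟨fun f hf ⟨h, hh⟩ => ?_, fun g hg => ?_⟩
  · let h' : GradedHom N M (-(i - 1)) := h.cast (by ring)
    obtain ⟨t, ht⟩ := h₁ (h'.compDGHom j.range.proj) fun x => by
      change j.range.quotient.d (j.range.proj.toFun (h.toFun x)) =
        ksign (i - 1) • j.range.proj.toFun (h.toFun (N.d x))
      have hx := congrArg j.range.proj.toFun (hh x)
      rw [hq, j.range.proj.map_add, hqz, j.range.proj.comm_d] at hx
      rw [ksign_sub_one, neg_smul, ← add_eq_zero_iff_eq_neg, ← hx]
    obtain ⟨t', ht'⟩ := sb.exists_lift _ t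
    obtain ⟨h₀, hh₀⟩ := (h'.subCoboundary t').exists_factor j hj fun x => by
      rw [← DGSubmodule.proj_eq_zero]
      change j.range.proj.toFun (h'.toFun x - (M.d (t'.toFun x) +
        ksign (i - 1) • t'.toFun (N.d x))) = 0
      rw [hqs, j.range.proj.map_add, hqz, j.range.proj.comm_d, ht', ht', sub_eq_zero]
      exact ht x
    replace hh₀ : ∀ x, j.toFun (h₀.toFun x) = h.toFun x - (M.d (t'.toFun x) +
      ksign (i - 1) • t'.toFun (N.d x)) := hh₀
    refine ⟨h₀.cast (by ring), fun x => hj ?_⟩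
    change _ = j.toFun (M'.d (h₀.toFun x) + ksign i • h₀.toFun (N.d x))
    rw [hh, j.map_add, hjz, j.comm_d, hh₀, hh₀, N.d_sq, t'.map_zero,
      M.d_sub, M.d_add, M.d_sq, M.d_zsmul, ksign_sub_one]
    module
  · obtain ⟨t, ht⟩ := h₂ (g.compDGHom j.range.proj) fun x => by
      change j.range.quotient.d (j.range.proj.toFun (g.toFun x)) =
        ksign i • j.range.proj.toFun (g.toFun (N.d x))
      rw [← j.range.proj.comm_d, hg, hqz]
    obtain ⟨t', ht'⟩ := sb.exists_lift _ t
    obtain ⟨f, hf⟩ := (g.subCoboundary t').exists_factor j hj fun x => by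
      rw [← DGSubmodule.proj_eq_zero]
      change j.range.proj.toFun (g.toFun x - (M.d (t'.toFun x) +
        ksign i • t'.toFun (N.d x))) = 0
      rw [hqs, j.range.proj.map_add, hqz, j.range.proj.comm_d, ht', ht', sub_eq_zero]
      exact ht x
    replace hf : ∀ x, j.toFun (f.toFun x) = g.toFun x - (M.d (t'.toFun x) +
      ksign i • t'.toFun (N.d x)) := hf
    refine ⟨f, fun x => hj ?_, t'.neg, fun x => ?_⟩
    · rw [j.comm_d, hjz, hf, hf, M.d_sub, M.d_add, M.d_sq, M.d_zsmul, hg, N.d_sq, t'.map_zero]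
      module
    · change _ = M.d (-t'.toFun x) + ksign i • -t'.toFun (N.d x)
      rw [hf, M.d_neg]
      module

/-- Let `φ : A → B` be DG quasi-smooth with diagonal ideal
`J = filt 1` and filtration `J^[ℓ] = filt ℓ`. If `N` is a semifree DG `B`-module
with `Ext^i_B(N, N ⊗_B J/J^[ℓ]) = 0` for all `i ≥ 0` and some fixed `ℓ ≥ 1`, then
the inclusion `J^[ℓ] ↪ J` induces isomorphisms
`Ext^i_B(N, N ⊗_B J^[ℓ]) ≅ Ext^i_B(N, N ⊗_B J)` for all `i ≥ 1`. -/
theorem ext_iso_of_ext_quot_vanish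
    {R : Type} [CommRing R] {A B : DGAlgebra R} (φ : DGAlgHom A B)
    (E : DGAlgebra R) (he : EnvelopingAlg φ E) (πB : DGAlgHom E B)
    (qs : QuasiSmoothData φ E he πB)
    (N : DGModule R B) (hsf : IsSemifree N)
    (ℓ : ℕ) (hℓ : 1 ≤ ℓ)
    (hext : ∀ i : ℤ, 0 ≤ i → ∀ P : DGModule R B,
      IsTensorSubquot φ he (qs.filt 1) (qs.filt ℓ) N P → ExtVanish i N P) :
    ∀ i : ℤ, 1 ≤ i →
      ∀ (Pl P : DGModule R B)
        (hPl : IsTensorSubquot φ he (qs.filt ℓ) ∅ N Pl)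
        (hP : IsTensorSubquot φ he (qs.filt 1) ∅ N P)
        (jmap : DGHom Pl P),
        (∀ (nn : N.carrier) (x : E.carrier), x ∈ qs.filt ℓ →
          jmap.toFun (hPl.pairing.pair nn x) = hP.pairing.pair nn x) →
        InducesExtIso i N jmap := by
  intro i hi Pl P hPl hP jmap hj
  have hle : qs.filt ℓ ⊆ qs.filt 1 := by
    have h : ∀ m, 1 ≤ m → qs.filt m ⊆ qs.filt 1 := fun m hm => by
      induction m, hm using Nat.le_induction with
      | base => exact subset_rfl
      | succ m hm ih => exact (qs.filt_desc m hm).trans ih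
    exact h ℓ hℓ
  obtain ⟨hQ⟩ := hPl.exists_quotient hle hP jmap hj
  exact inducesExtIso_of_injective hsf jmap
    (hPl.injective_of_semifree qs hle hsf hP jmap hj) i
    (hext (i - 1) (by omega) _ hQ) (hext i (by omega) _ hQ)
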